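/- arXiv:2011.02979 — 3 statements merged into one kernel-verified Lean document; each statement's English description precedes it below -/
import Mathlib

section
/- Let T > 0, κ > 0, γ > 0 and λ > γ/2 be real numbers and set α := 2κ/(2λ − γ). Define V(t, y) := −(γ/2 + κ/(T − t + α))·y² for t ∈ [0, T] and y ∈ ℝ. Then for every t ∈ [0, T) and every y ∈ ℝ one has ∂V/∂t(t, y) + (1/(4κ))·(∂V/∂y(t, y) + γy)² = 0, and V(T, y) = −λy² for all y ∈ ℝ. -/
/-- With `α = 2κ/(2λ - γ)` and `V(t, y) = -(γ/2 + κ/(T - t + α))·y²`,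
for every `t ∈ [0, T)` and `y ∈ ℝ` one has
`∂V/∂t(t, y) + (1/(4κ))·(∂V/∂y(t, y) + γy)² = 0`, and `V(T, y) = -λy²`. -/
theorem stmt_3 (T κ γ lam : ℝ) (hT : 0 < T) (hκ : 0 < κ) (hγ : 0 < γ)
    (hlam : γ / 2 < lam) :
    let α := 2 * κ / (2 * lam - γ)
    let V : ℝ → ℝ → ℝ := fun t y => -(γ / 2 + κ / (T - t + α)) * y ^ 2
    (∀ t ∈ Set.Ico (0 : ℝ) T, ∀ y : ℝ,
        deriv (fun s => V s y) t
          + (1 / (4 * κ)) * (deriv (fun z => V t z) y + γ * y) ^ 2 = 0) ∧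
      ∀ y : ℝ, V T y = -lam * y ^ 2 := by
  intro α V
  have hd : 0 < 2 * lam - γ := by linarith
  have hα : 0 < α := div_pos (by linarith) hd
  refine ⟨fun t ht y => ?_, fun y => ?_⟩
  · have hD : T - t + α ≠ 0 := by linarith [ht.2]
    have ht' : HasDerivAt (fun s => V s y) (-(κ / (T - t + α) ^ 2) * y ^ 2) t := by
      have h := (((((hasDerivAt_id t).const_sub T).add_const α).fun_inv hD).const_mul κ
        |>.const_add (γ / 2)).neg.mul_const (y ^ 2)
      refine h.congr_deriv ?_
      simp only [id]
      ring
    have hy' : HasDerivAt (fun z => V t z) (-(γ / 2 + κ / (T - t + α)) * (2 * y)) y := by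
      simpa [V] using (hasDerivAt_pow 2 y).const_mul (-(γ / 2 + κ / (T - t + α)))
    rw [ht'.deriv, hy'.deriv]
    field_simp
    ring
  · have hκα : κ / α = (2 * lam - γ) / 2 := by
      simp only [α]
      field_simp
    simp only [V, sub_self, zero_add, hκα]
    ring
end

section
/- Let T > 0, κ > 0, γ > 0, λ > γ/2, μ ∈ ℝ, φ₀ > 0 and B ∈ ℝ, and set α := 2κ/(2λ − γ) and a(t) := −γ/2 − κ/(T − t + α). Then there exist continuously differentiable functions b, c : [0, T] → ℝ with b(T) = c(T) = 0 such that the function V(t, y) := a(t)y² + b(t)y + c(t) satisfies, for all t ∈ [0, T) and all y ∈ ℝ, the Hamilton–Jacobi–Bellman equation ∂V/∂t + (1/(4κ))·((φ₀²/2)(T − t)·∂²V/∂y² + B(T − t) − (∂V/∂y + γy))² + μy = 0, together with the final condition V(T, y) = −λy² for all y ∈ ℝ. -/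
/-- A continuous function on `(-∞, M)` has a continuously differentiable primitive vanishing at a
prescribed point. -/
theorem exists_primitive_contDiffOn_Iio {f : ℝ → ℝ} {M T : ℝ} (hT : T < M)
    (hf : ContinuousOn f (Set.Iio M)) :
    ∃ F : ℝ → ℝ, F T = 0 ∧ (∀ t < M, HasDerivAt F (f t) t) ∧ ContDiffOn ℝ 1 F (Set.Iio M) := by
  have hderiv : ∀ t < M, HasDerivAt (fun x => ∫ s in T..x, f s) (f t) t := fun t ht => by
    refine intervalIntegral.integral_hasDerivAt_right ?_ ?_
      (hf.continuousAt (Iio_mem_nhds ht))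
    · exact (hf.mono fun x hx => lt_of_le_of_lt hx.2 (max_lt hT ht)).intervalIntegrable
    · exact hf.stronglyMeasurableAtFilter isOpen_Iio t ht
  refine ⟨fun x => ∫ s in T..x, f s, by simp, hderiv, ?_⟩
  rw [show (1 : WithTop ℕ∞) = 0 + 1 by simp, contDiffOn_succ_iff_deriv_of_isOpen isOpen_Iio]
  refine ⟨fun t ht => (hderiv t ht).differentiableAt.differentiableWithinAt, by simp, ?_⟩
  rw [contDiffOn_zero]
  exact hf.congr fun t ht => (hderiv t ht).deriv

/-- The derivative of a quadratic polynomial. -/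
theorem deriv_quadratic (p q r : ℝ) :
    deriv (fun z : ℝ => p * z ^ 2 + q * z + r) = fun z => 2 * p * z + q := by
  funext z
  have h := (((hasDerivAt_pow 2 z).const_mul p).add ((hasDerivAt_id z).const_mul q)).add_const r
  refine (h.congr_deriv ?_).deriv
  simp
  ring


/-- With `α = 2κ/(2λ - γ)` and `a(t) = -γ/2 - κ/(T - t + α)`, there exist
continuously differentiable `b, c : [0, T] → ℝ` with `b(T) = c(T) = 0` such that
`V(t, y) = a(t)y² + b(t)y + c(t)` satisfies the Hamilton–Jacobi–Bellman equation
`∂V/∂t + (1/(4κ))·((φ₀²/2)(T - t)·∂²V/∂y² + B(T - t) - (∂V/∂y + γy))² + μy = 0`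
for all `t ∈ [0, T)`, `y ∈ ℝ`, together with the final condition `V(T, y) = -λy²`. -/
theorem stmt_4 (T κ γ lam μ φ₀ B : ℝ) (hT : 0 < T) (hκ : 0 < κ) (hγ : 0 < γ)
    (hlam : γ / 2 < lam) (hφ₀ : 0 < φ₀) :
    let α := 2 * κ / (2 * lam - γ)
    let a : ℝ → ℝ := fun t => -γ / 2 - κ / (T - t + α)
    ∃ b c : ℝ → ℝ,
      ContDiffOn ℝ 1 b (Set.Icc 0 T) ∧ ContDiffOn ℝ 1 c (Set.Icc 0 T) ∧
      b T = 0 ∧ c T = 0 ∧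
      (∀ t ∈ Set.Ico (0 : ℝ) T, ∀ y : ℝ,
        deriv (fun s => a s * y ^ 2 + b s * y + c s) t
          + (1 / (4 * κ)) *
            ((φ₀ ^ 2 / 2) * (T - t) *
                deriv (deriv (fun z => a t * z ^ 2 + b t * z + c t)) y
              + B * (T - t)
              - (deriv (fun z => a t * z ^ 2 + b t * z + c t) y + γ * y)) ^ 2
          + μ * y = 0) ∧
      ∀ y : ℝ, a T * y ^ 2 + b T * y + c T = -lam * y ^ 2 := by
  intro α a
  have hden : 0 < 2 * lam - γ := by linarith
  have hα : 0 < α := by positivity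
  have hTM : T < T + α := by linarith
  have hu : ∀ t ∈ Set.Iio (T + α), T - t + α ≠ 0 := fun t ht => by
    have : t < T + α := ht
    linarith
  have ha : ContinuousOn a (Set.Iio (T + α)) :=
    continuousOn_const.sub (continuousOn_const.div (by fun_prop) hu)
  obtain ⟨P, hPT, hP, hPC⟩ := exists_primitive_contDiffOn_Iio
    (f := fun t => -μ * (T - t + α) - (φ₀ ^ 2 * a t + B) * (T - t)) hTM (by fun_prop)
  have hbC : ContDiffOn ℝ 1 (fun t => P t / (T - t + α)) (Set.Iio (T + α)) :=
    hPC.div (by fun_prop) hu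
  have hbcont := hbC.continuousOn
  obtain ⟨c, hcT, hc, hcC⟩ := exists_primitive_contDiffOn_Iio
    (f := fun t => -(1 / (4 * κ)) * ((φ₀ ^ 2 * a t + B) * (T - t) - P t / (T - t + α)) ^ 2) hTM
    (by fun_prop)
  have hsub : Set.Icc 0 T ⊆ Set.Iio (T + α) := fun t ht => lt_of_le_of_lt ht.2 hTM
  refine ⟨fun t => P t / (T - t + α), c, hbC.mono hsub, hcC.mono hsub, by simp [hPT], hcT, ?_, ?_⟩
  · intro t ht y
    have htM : t < T + α := ht.2.trans hTM
    have hut := hu t htM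
    have hud : HasDerivAt (fun s => T - s + α) (-1) t :=
      ((hasDerivAt_id t).const_sub T).add_const α
    have had : HasDerivAt a (-κ / (T - t + α) ^ 2) t :=
      (((hasDerivAt_const t κ).div hud hut).const_sub (-γ / 2)).congr_deriv (by ring)
    have hV := ((had.mul_const (y ^ 2)).add (((hP t htM).div hud hut).mul_const y)).add (hc t htM)
    have hVd : deriv (fun s => a s * y ^ 2 + P s / (T - s + α) * y + c s) t = _ := hV.deriv
    have hlin : deriv (fun z => 2 * a t * z + P t / (T - t + α)) y = 2 * a t := by
      simp
    beta_reduce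
    rw [hVd, deriv_quadratic, hlin]
    simp only [a]
    field_simp
    ring
  · intro y
    have haT : a T = -lam := by
      simp only [a, α, sub_self, zero_add]
      field_simp
      ring
    simp [hPT, hcT, haT]
end

section
/- Let T > 0, κ > 0, γ > 0, μ ∈ ℝ, B ∈ ℝ and φ₀ > 0. For λ > γ/2 set α(λ) := 2κ/(2λ − γ) and define the optimal scheduled trading rate v*_λ(t, y) := y/(T − t + α(λ)) − (1/(4κ))(μ + B)(T − t + α(λ) − α(λ)²/(T − t + α(λ))) + (1/(2κ))B(T − t) + (α(λ)/(2κ))·( B(T − t)/(T − t + α(λ)) − (κφ₀²/(T − t + α(λ)))·ln((T − t + α(λ))/α(λ)) ). Then, for every fixed t ∈ [0, T) and every y ∈ ℝ, lim_{λ → +∞} v*_λ(t, y) = y/(T − t) − (1/(4κ))(μ − B)(T − t). -/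
open Filter Topology

/-- For `s > 0`, the quantity `a * log ((s + a) / a)` vanishes as `a → 0⁺`. -/
lemma tendsto_mul_log_add_div_self {s : ℝ} (hs : 0 < s) :
    Tendsto (fun a : ℝ => a * Real.log ((s + a) / a)) (𝓝[>] 0) (𝓝 0) := by
  have hlog : ContinuousAt (fun a : ℝ => a * Real.log (s + a) - a * Real.log a) 0 := by
    refine ContinuousAt.sub ?_ Real.continuous_mul_log.continuousAt
    exact continuousAt_id.mul ((continuousAt_const.add continuousAt_id).log (by simpa using hs.ne'))
  have hlim : Tendsto (fun a : ℝ => a * Real.log (s + a) - a * Real.log a) (𝓝[>] 0) (𝓝 0) := by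
    simpa using hlog.tendsto.mono_left nhdsWithin_le_nhds
  refine hlim.congr' ?_
  filter_upwards [self_mem_nhdsWithin] with a (ha : 0 < a)
  rw [Real.log_div (by positivity) ha.ne']
  ring

/-- `c / (2 * x - d)` tends to `0` from the right as `x → +∞`, for `c > 0`. -/
lemma tendsto_div_two_mul_sub_atTop {c : ℝ} (hc : 0 < c) (d : ℝ) :
    Tendsto (fun x : ℝ => c / (2 * x - d)) atTop (𝓝[>] 0) := by
  have h : Tendsto (fun x : ℝ => 2 * x - d) atTop atTop :=
    tendsto_atTop_add_const_right _ (-d) (tendsto_id.const_mul_atTop two_pos)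
  refine tendsto_nhdsWithin_iff.2 ⟨h.const_div_atTop c, ?_⟩
  filter_upwards [h.eventually_gt_atTop 0] with x hx
  exact div_pos hc hx

/-- For fixed `t ∈ [0, T)` and `y ∈ ℝ`, the optimal scheduled trading rate
`v*_λ(t, y)` (with `α(λ) = 2κ/(2λ - γ)`) converges, as `λ → +∞`, to
`y/(T - t) - (1/(4κ))(μ - B)(T - t)`. -/
theorem stmt_5 (T κ γ μ B φ₀ : ℝ) (hT : 0 < T) (hκ : 0 < κ) (hγ : 0 < γ)
    (hφ₀ : 0 < φ₀) (t y : ℝ) (ht : t ∈ Set.Ico 0 T) :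
    Filter.Tendsto
      (fun lam : ℝ =>
        let α := 2 * κ / (2 * lam - γ)
        y / (T - t + α)
          - (1 / (4 * κ)) * (μ + B) * (T - t + α - α ^ 2 / (T - t + α))
          + (1 / (2 * κ)) * B * (T - t)
          + (α / (2 * κ)) * (B * (T - t) / (T - t + α)
              - (κ * φ₀ ^ 2 / (T - t + α)) * Real.log ((T - t + α) / α)))
      Filter.atTop
      (nhds (y / (T - t) - (1 / (4 * κ)) * (μ - B) * (T - t))) := by
  have hs : 0 < T - t := sub_pos.2 ht.2
  generalize T - t = s at hs ⊢
  have hrat : ContinuousAt (fun a : ℝ => y / (s + a)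
      - (1 / (4 * κ)) * (μ + B) * (s + a - a ^ 2 / (s + a))
      + (1 / (2 * κ)) * B * s + (a / (2 * κ)) * (B * s / (s + a))) 0 := by
    have h0 : s + 0 ≠ 0 := by simpa using hs.ne'
    fun_prop (disch := assumption)
  have hcoef : ContinuousAt (fun a : ℝ => φ₀ ^ 2 / (2 * (s + a))) 0 := by
    have h0 : 2 * (s + 0) ≠ 0 := by simpa using hs.ne'
    fun_prop (disch := assumption)
  have hlim := (hrat.tendsto.mono_left nhdsWithin_le_nhds).sub
    ((hcoef.tendsto.mono_left nhdsWithin_le_nhds).mul (tendsto_mul_log_add_div_self hs))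
  have hα := tendsto_div_two_mul_sub_atTop (by positivity : 0 < 2 * κ) γ
  convert (hlim.comp hα).congr' ?_ using 2
  · simp only [add_zero, mul_zero, sub_zero, zero_div, zero_mul, ne_eq, OfNat.ofNat_ne_zero,
      not_false_eq_true, zero_pow]
    field_simp
    ring
  · filter_upwards [hα.eventually self_mem_nhdsWithin] with x (hx : 0 < 2 * κ / (2 * x - γ))
    simp only [Function.comp_apply]
    generalize 2 * κ / (2 * x - γ) = a at hx ⊢
    have hsa : s + a ≠ 0 := by positivity
    generalize Real.log ((s + a) / a) = l
    field_simp
    ring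
end
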